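/- arXiv:1811.00732 — 8 statements merged into one kernel-verified Lean document; each statement's English description precedes it below -/
import Mathlib

section
/- Suppose the effective relay-path rate satisfies r_C > 2·R_th, and the price c satisfies 0 ≤ c ≤ c_lo, where c_lo = β₂·P_D/2 + β₁·r_C/(r_C − 2·R_th). Then α = R_th/r_C belongs to the follower's feasible set F, and for every α' ∈ F one has U_D(α', c) ≤ U_D(R_th/r_C, c); that is, R_th/r_C maximizes the follower payoff U_D(·, c) over F. -/
/-- The D2D (follower) payoff U_D(α, c). -/
noncomputable def UD (β₁ β₂ P_D r_D c α : ℝ) : ℝ :=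
  β₁ * Real.log ((1 - 2 * α) * r_D) - β₂ * P_D * α - c * (1 - 2 * α)

/-- The follower's feasible set F. -/
def F (r_C R_th : ℝ) : Set ℝ := {α : ℝ | 0 < α ∧ α < 1 / 2 ∧ α * r_C ≥ R_th}

/-- if r_C > 2 R_th and 0 ≤ c ≤ c_lo, then α = R_th/r_C is feasible and
maximizes the follower payoff U_D(·, c) over F. -/
theorem stmt0 (β₁ β₂ P_D r_C r_D R_th c : ℝ)
    (hβ₁ : 0 < β₁) (hβ₂ : 0 < β₂) (hPD : 0 < P_D) (hrC : 0 < r_C) (hrD : 0 < r_D)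
    (hRth : 0 < R_th)
    (hfeas : r_C > 2 * R_th)
    (hc0 : 0 ≤ c)
    (hc : c ≤ β₂ * P_D / 2 + β₁ * r_C / (r_C - 2 * R_th)) :
    R_th / r_C ∈ F r_C R_th ∧
      ∀ α' ∈ F r_C R_th, UD β₁ β₂ P_D r_D c α' ≤ UD β₁ β₂ P_D r_D c (R_th / r_C) := by
  have hy : 0 < 1 - 2 * (R_th / r_C) := by
    have : R_th / r_C < 1 / 2 := by rw [div_lt_iff₀ hrC]; linarith
    linarith
  refine ⟨⟨div_pos hRth hrC, by linarith, (div_mul_cancel₀ R_th hrC.ne').ge⟩, ?_⟩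
  rintro a ⟨-, ha, har⟩
  have hle : R_th / r_C ≤ a := (div_le_iff₀ hrC).2 har
  have hprice : β₁ * r_C / (r_C - 2 * R_th) = β₁ / (1 - 2 * (R_th / r_C)) := by
    have hmul : r_C - 2 * R_th = (1 - 2 * (R_th / r_C)) * r_C := by field_simp
    rw [hmul, mul_div_mul_right _ _ hrC.ne']
  rw [hprice] at hc
  unfold UD
  generalize R_th / r_C = s at *
  have hx : 0 < 1 - 2 * a := by linarith
  rw [Real.log_mul hx.ne' hrD.ne', Real.log_mul hy.ne' hrD.ne']
  have hlog : Real.log (1 - 2 * a) - Real.log (1 - 2 * s) ≤ -(2 * (a - s)) / (1 - 2 * s) := by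
    rw [← Real.log_div hx.ne' hy.ne']
    refine (Real.log_le_sub_one_of_pos (div_pos hx hy)).trans_eq ?_
    field_simp
    ring
  have hgain := mul_le_mul_of_nonneg_left hlog hβ₁.le
  have hcost := mul_le_mul_of_nonneg_right hc (sub_nonneg.2 hle)
  have heq : β₁ * (-(2 * (a - s)) / (1 - 2 * s)) = -2 * (β₁ / (1 - 2 * s) * (a - s)) := by ring
  linarith
end

section
/- Suppose the effective relay-path rate satisfies r_C > 2·R_th, and the price c satisfies c > c_lo, where c_lo = β₂·P_D/2 + β₁·r_C/(r_C − 2·R_th). Then α* = 1/2 − β₁/(2c − β₂·P_D) belongs to the follower's feasible set F, and for every α' ∈ F one has U_D(α', c) ≤ U_D(α*, c); that is, α* maximizes the follower payoff U_D(·, c) over F. -/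
/-- if r_C > 2 R_th and c > c_lo, then α* = 1/2 − β₁/(2c − β₂ P_D) is feasible
and maximizes the follower payoff U_D(·, c) over F. -/
theorem stmt1 (β₁ β₂ P_D r_C r_D R_th c : ℝ)
    (hβ₁ : 0 < β₁) (hβ₂ : 0 < β₂) (hPD : 0 < P_D) (hrC : 0 < r_C) (hrD : 0 < r_D)
    (hRth : 0 < R_th)
    (hfeas : r_C > 2 * R_th)
    (hc : c > β₂ * P_D / 2 + β₁ * r_C / (r_C - 2 * R_th)) :
    (1 / 2 - β₁ / (2 * c - β₂ * P_D)) ∈ F r_C R_th ∧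
      ∀ α' ∈ F r_C R_th,
        UD β₁ β₂ P_D r_D c α' ≤ UD β₁ β₂ P_D r_D c (1 / 2 - β₁ / (2 * c - β₂ * P_D)) := by
  have hgap : 0 < r_C - 2 * R_th := by linarith
  have hprice : 2 * (β₁ * r_C / (r_C - 2 * R_th)) < 2 * c - β₂ * P_D := by linarith
  generalize hK : 2 * c - β₂ * P_D = K at *
  have hK0 : 0 < K := lt_trans (by positivity) hprice
  have hKgap : 2 * (β₁ * r_C) < K * (r_C - 2 * R_th) := by
    rwa [← mul_div_assoc, div_lt_iff₀ hgap] at hprice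
  have ht0 : 0 < β₁ / K := by positivity
  have hβK : β₁ = β₁ / K * K := by field_simp
  generalize β₁ / K = t at *
  have hrate : R_th < (1 / 2 - t) * r_C := by
    rw [hβK] at hKgap
    have : K * (2 * (t * r_C)) < K * (r_C - 2 * R_th) := by linarith
    linarith [lt_of_mul_lt_mul_left this hK0.le]
  refine ⟨⟨pos_of_mul_pos_left (hRth.trans hrate) hrC.le, by linarith, hrate.le⟩, ?_⟩
  rintro a ⟨-, ha, -⟩
  have hx : 0 < 1 - 2 * a := by linarith
  have hlog := Real.log_le_sub_one_of_pos (div_pos hx (mul_pos two_pos ht0))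
  rw [Real.log_div hx.ne' (mul_pos two_pos ht0).ne'] at hlog
  have hscaled := mul_le_mul_of_nonneg_left hlog hβ₁.le
  have hlin : β₁ * ((1 - 2 * a) / (2 * t) - 1) = K * (1 - 2 * a) / 2 - K * t := by
    rw [hβK]
    field_simp
  have hc_eq : c = (K + β₂ * P_D) / 2 := by linarith
  unfold UD
  rw [show 1 - 2 * (1 / 2 - t) = 2 * t by ring, Real.log_mul hx.ne' hrD.ne',
    Real.log_mul (mul_pos two_pos ht0).ne' hrD.ne', hc_eq]
  linarith
end

section
/- Assume r_C > 2·R_th and β₁·Real.log((1 − 2·R_th/r_C)·r_D) − β₂·P_D·R_th/r_C ≥ 0. Define c₁ = min{c_lo, (β₁·Real.log((1 − 2·R_th/r_C)·r_D) − β₂·P_D·R_th/r_C)/(1 − 2·R_th/r_C)}, c₂ = β₂·P_D/2 + β₁·β₂·P_D/(β₂·P_D − 2·β₁), and the candidate set 𝒞 = {c₁, c₂} if c_lo < c₂ ∧ c₂ < c_hi, 𝒞 = {c₁} if c_hi < c_lo, and 𝒞 = {c₁, c_hi, c_lo} otherwise. Then there exists c* ∈ 𝒞 with c* ≥ 0 and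 U_D(α*(c*), c*) ≥ 0 such that for every price c ≥ 0 satisfying the follower-participation constraint U_D(α*(c), c) ≥ 0, one has U_C(α*(c), c) ≤ U_C(α*(c*), c*); that is, the leader's payoff over the feasible price set is maximized at a point of 𝒞 (so (c*, α*(c*)) is a Stackelberg equilibrium). -/
open scoped Classical

/-- The cell-edge-user (leader) payoff U_C(α, c). -/
noncomputable def UC (β₁ r_C c α : ℝ) : ℝ :=
  β₁ * Real.log (α * r_C) + c * (1 - 2 * α)

/-- The price threshold c_lo. -/
noncomputable def clo (β₁ β₂ P_D r_C R_th : ℝ) : ℝ :=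
  β₂ * P_D / 2 + β₁ * r_C / (r_C - 2 * R_th)

/-- The price threshold c_hi. -/
noncomputable def chi (β₁ β₂ P_D r_D : ℝ) : ℝ :=
  β₂ * P_D / 2 + β₁ * r_D * Real.exp (-(1 + β₂ * P_D / (2 * β₁)))

/-- The follower best response α*(c). -/
noncomputable def astar (β₁ β₂ P_D r_C R_th c : ℝ) : ℝ :=
  if c ≤ clo β₁ β₂ P_D r_C R_th then R_th / r_C else 1 / 2 - β₁ / (2 * c - β₂ * P_D)

/-- The candidate price c₁. -/
noncomputable def cOne (β₁ β₂ P_D r_C r_D R_th : ℝ) : ℝ :=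
  min (clo β₁ β₂ P_D r_C R_th)
    ((β₁ * Real.log ((1 - 2 * R_th / r_C) * r_D) - β₂ * P_D * R_th / r_C) /
      (1 - 2 * R_th / r_C))

/-- The candidate price c₂. -/
noncomputable def cTwo (β₁ β₂ P_D : ℝ) : ℝ :=
  β₂ * P_D / 2 + β₁ * β₂ * P_D / (β₂ * P_D - 2 * β₁)

/-- The candidate price set 𝒞. -/
noncomputable def candSet (β₁ β₂ P_D r_C r_D R_th : ℝ) : Set ℝ :=
  if clo β₁ β₂ P_D r_C R_th < cTwo β₁ β₂ P_D ∧ cTwo β₁ β₂ P_D < chi β₁ β₂ P_D r_D then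
    {cOne β₁ β₂ P_D r_C r_D R_th, cTwo β₁ β₂ P_D}
  else if chi β₁ β₂ P_D r_D < clo β₁ β₂ P_D r_C R_th then
    {cOne β₁ β₂ P_D r_C r_D R_th}
  else
    {cOne β₁ β₂ P_D r_C r_D R_th, chi β₁ β₂ P_D r_D, clo β₁ β₂ P_D r_C R_th}

/-- Above the threshold, follower participation is the price cap c_hi. -/
theorem UD_nonneg_iff_le_chi {β₁ β₂ P_D r_D c : ℝ} (hβ₁ : 0 < β₁) (hrD : 0 < r_D)
    (hc : 0 < c - β₂ * P_D / 2) :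
    0 ≤ UD β₁ β₂ P_D r_D c (1 / 2 - β₁ / (2 * c - β₂ * P_D)) ↔ c ≤ chi β₁ β₂ P_D r_D := by
  obtain ⟨p, rfl⟩ : ∃ p, c = p + β₂ * P_D / 2 := ⟨c - β₂ * P_D / 2, by ring⟩
  have hp : 0 < p := by linarith
  have hα : 1 / 2 - β₁ / (2 * (p + β₂ * P_D / 2) - β₂ * P_D) = 1 / 2 - β₁ / (2 * p) := by
    congr 2; ring
  have hUD : UD β₁ β₂ P_D r_D (p + β₂ * P_D / 2) (1 / 2 - β₁ / (2 * p)) =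
      β₁ * (Real.log (β₁ * r_D / p) - (1 + β₂ * P_D / (2 * β₁))) := by
    have hlog : (1 - 2 * (1 / 2 - β₁ / (2 * p))) * r_D = β₁ * r_D / p := by
      field_simp; ring
    rw [UD, hlog]
    field_simp
    ring
  rw [hα, hUD, mul_nonneg_iff_of_pos_left hβ₁, sub_nonneg,
    Real.le_log_iff_exp_le (by positivity), le_div_iff₀ hp, chi, Real.exp_neg,
    ← div_eq_mul_inv, add_comm p, add_le_add_iff_left, le_div_iff₀ (Real.exp_pos _), mul_comm p]

/-- Tangent-line comparison of leader payoffs along the interior best response: the payoff is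
concave in the fraction `1 - 2 * α`. -/
theorem UC_le_UC_of_tangent {β₁ k r_C c d : ℝ} (hβ₁ : 0 < β₁) (hrC : 0 < r_C)
    (hc : β₁ < c - k / 2) (hd : β₁ < d - k / 2)
    (h : 0 ≤ (2 * β₁ * (d - k / 2) - k * (d - k / 2 - β₁)) * (d - c)) :
    UC β₁ r_C c (1 / 2 - β₁ / (2 * c - k)) ≤ UC β₁ r_C d (1 / 2 - β₁ / (2 * d - k)) := by
  obtain ⟨p, rfl⟩ : ∃ p, c = p + k / 2 := ⟨c - k / 2, by ring⟩
  obtain ⟨q, rfl⟩ : ∃ q, d = q + k / 2 := ⟨d - k / 2, by ring⟩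
  simp only [add_sub_cancel_right, add_sub_add_right_eq_sub] at hc hd h
  have hp : 0 < p := hβ₁.trans hc
  have hq : 0 < q := hβ₁.trans hd
  have hpb : 0 < p - β₁ := sub_pos.2 hc
  have hqb : 0 < q - β₁ := sub_pos.2 hd
  have hX : (1 / 2 - β₁ / (2 * (p + k / 2) - k)) = (p - β₁) / (2 * p) := by
    rw [show 2 * (p + k / 2) - k = 2 * p by ring]; field_simp
  have hY : (1 / 2 - β₁ / (2 * (q + k / 2) - k)) = (q - β₁) / (2 * q) := by
    rw [show 2 * (q + k / 2) - k = 2 * q by ring]; field_simp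
  have hX0 : 0 < (p - β₁) / (2 * p) * r_C := by positivity
  have hY0 : 0 < (q - β₁) / (2 * q) * r_C := by positivity
  have hlog := Real.log_le_sub_one_of_pos (div_pos hX0 hY0)
  rw [Real.log_div hX0.ne' hY0.ne'] at hlog
  have hmul := mul_le_mul_of_nonneg_left hlog hβ₁.le
  have hgap : (q + k / 2) * (1 - 2 * ((q - β₁) / (2 * q))) -
      (p + k / 2) * (1 - 2 * ((p - β₁) / (2 * p))) -
      β₁ * ((p - β₁) / (2 * p) * r_C / ((q - β₁) / (2 * q) * r_C) - 1) =
      β₁ * ((2 * β₁ * q - k * (q - β₁)) * (q - p)) / (2 * p * q * (q - β₁)) := by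
    field_simp
    ring
  have hgap0 : 0 ≤ β₁ * ((2 * β₁ * q - k * (q - β₁)) * (q - p)) / (2 * p * q * (q - β₁)) := by
    positivity
  rw [hX, hY, UC, UC]
  linarith

/-- The best response is given by the interior formula also at the threshold c_lo. -/
theorem astar_of_clo_le {β₁ β₂ P_D r_C R_th c : ℝ} (hβ₁ : 0 < β₁) (hrC : 0 < r_C)
    (h : 2 * R_th < r_C) (hc : clo β₁ β₂ P_D r_C R_th ≤ c) :
    astar β₁ β₂ P_D r_C R_th c = 1 / 2 - β₁ / (2 * c - β₂ * P_D) := by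
  rcases hc.eq_or_lt with rfl | hlt
  · have : 0 < r_C - 2 * R_th := sub_pos.2 h
    rw [astar, if_pos le_rfl, clo, show 2 * (β₂ * P_D / 2 + β₁ * r_C / (r_C - 2 * R_th)) -
      β₂ * P_D = 2 * (β₁ * r_C / (r_C - 2 * R_th)) by ring]
    field_simp
    ring
  · rw [astar, if_neg hlt.not_ge]

/-- under the two feasibility conditions, the leader's payoff over the
feasible price set is maximized at a point c* of the candidate set 𝒞, so
(c*, α*(c*)) is a Stackelberg equilibrium. -/
theorem stmt3 (β₁ β₂ P_D r_C r_D R_th : ℝ)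
    (hβ₁ : 0 < β₁) (hβ₂ : 0 < β₂) (hPD : 0 < P_D) (hrC : 0 < r_C) (hrD : 0 < r_D)
    (hRth : 0 < R_th)
    (hfeas1 : r_C > 2 * R_th)
    (hfeas2 : β₁ * Real.log ((1 - 2 * R_th / r_C) * r_D) - β₂ * P_D * R_th / r_C ≥ 0) :
    ∃ cstar ∈ candSet β₁ β₂ P_D r_C r_D R_th,
      cstar ≥ 0 ∧
      UD β₁ β₂ P_D r_D cstar (astar β₁ β₂ P_D r_C R_th cstar) ≥ 0 ∧
      ∀ c : ℝ, c ≥ 0 → UD β₁ β₂ P_D r_D c (astar β₁ β₂ P_D r_C R_th c) ≥ 0 →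
        UC β₁ r_C c (astar β₁ β₂ P_D r_C R_th c) ≤
          UC β₁ r_C cstar (astar β₁ β₂ P_D r_C R_th cstar) := by
  set L := clo β₁ β₂ P_D r_C R_th with hL
  set H := chi β₁ β₂ P_D r_D
  set C₁ := cOne β₁ β₂ P_D r_C r_D R_th
  set A := astar β₁ β₂ P_D r_C R_th
  have hk : 0 < β₂ * P_D := mul_pos hβ₂ hPD
  have hs : 0 < 1 - 2 * R_th / r_C := by
    rw [sub_pos, div_lt_one hrC]; exact hfeas1
  have hLb : β₁ < L - β₂ * P_D / 2 := by
    rw [hL, clo, add_sub_cancel_left, lt_div_iff₀ (sub_pos.2 hfeas1)]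
    nlinarith [mul_pos hβ₁ hRth]
  have hL0 : 0 ≤ L := by linarith
  have hlow : ∀ c ≤ L, A c = R_th / r_C := fun c hc => if_pos hc
  have hhigh : ∀ c, L ≤ c → A c = 1 / 2 - β₁ / (2 * c - β₂ * P_D) :=
    fun c hc => astar_of_clo_le hβ₁ hrC hfeas1 hc
  have hUDlow : ∀ c ≤ L, (0 ≤ UD β₁ β₂ P_D r_D c (A c) ↔
      c ≤ (β₁ * Real.log ((1 - 2 * R_th / r_C) * r_D) - β₂ * P_D * R_th / r_C) /
        (1 - 2 * R_th / r_C)) := by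
    intro c hc
    rw [hlow c hc, UD, le_div_iff₀ hs, sub_nonneg, mul_div_assoc 2, mul_div_assoc (β₂ * P_D)]
  have hUDhigh : ∀ c, L ≤ c → (0 ≤ UD β₁ β₂ P_D r_D c (A c) ↔ c ≤ H) := by
    intro c hc
    rw [hhigh c hc]
    exact UD_nonneg_iff_le_chi hβ₁ hrD (by linarith)
  have hC₁L : C₁ ≤ L := min_le_left _ _
  have hC₁0 : 0 ≤ C₁ := le_min hL0 (div_nonneg hfeas2 hs.le)
  have hC₁UD : 0 ≤ UD β₁ β₂ P_D r_D C₁ (A C₁) := (hUDlow C₁ hC₁L).2 (min_le_right _ _)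
  have hC₁max : ∀ c ≤ L, 0 ≤ UD β₁ β₂ P_D r_D c (A c) →
      UC β₁ r_C c (A c) ≤ UC β₁ r_C C₁ (A C₁) := by
    intro c hc hU
    have hcC : c ≤ C₁ := le_min hc ((hUDlow c hc).1 hU)
    rw [hlow c hc, hlow C₁ hC₁L, UC, UC, ← mul_div_assoc]
    gcongr
  have combine : ∀ d, C₁ ∈ candSet β₁ β₂ P_D r_C r_D R_th → d ∈ candSet β₁ β₂ P_D r_C r_D R_th →
      L ≤ d → d ≤ H →
      (∀ c, L ≤ c → c ≤ H →
        0 ≤ (2 * β₁ * (d - β₂ * P_D / 2) - β₂ * P_D * (d - β₂ * P_D / 2 - β₁)) * (d - c)) →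
      ∃ cstar ∈ candSet β₁ β₂ P_D r_C r_D R_th, cstar ≥ 0 ∧
        UD β₁ β₂ P_D r_D cstar (A cstar) ≥ 0 ∧
        ∀ c : ℝ, c ≥ 0 → UD β₁ β₂ P_D r_D c (A c) ≥ 0 →
          UC β₁ r_C c (A c) ≤ UC β₁ r_C cstar (A cstar) := by
    intro d hC₁mem hdmem hLd hdH htan
    have hdmax : ∀ c, L ≤ c → 0 ≤ UD β₁ β₂ P_D r_D c (A c) →
        UC β₁ r_C c (A c) ≤ UC β₁ r_C d (A d) := by
      intro c hc hU
      rw [hhigh c hc, hhigh d hLd]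
      exact UC_le_UC_of_tangent hβ₁ hrC (by linarith) (by linarith)
        (htan c hc ((hUDhigh c hc).1 hU))
    rcases le_total (UC β₁ r_C C₁ (A C₁)) (UC β₁ r_C d (A d)) with hle | hle
    · refine ⟨d, hdmem, hL0.trans hLd, (hUDhigh d hLd).2 hdH, fun c _ hU => ?_⟩
      rcases le_total c L with hc | hc
      · exact (hC₁max c hc hU).trans hle
      · exact hdmax c hc hU
    · refine ⟨C₁, hC₁mem, hC₁0, hC₁UD, fun c _ hU => ?_⟩
      rcases le_total c L with hc | hc
      · exact hC₁max c hc hU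
      · exact (hdmax c hc hU).trans hle
  by_cases h1 : L < cTwo β₁ β₂ P_D ∧ cTwo β₁ β₂ P_D < H
  · have hcand : candSet β₁ β₂ P_D r_C r_D R_th = {C₁, cTwo β₁ β₂ P_D} := if_pos h1
    refine combine (cTwo β₁ β₂ P_D) (by simp [hcand]) (by simp [hcand]) h1.1.le h1.2.le
      fun c _ _ => ?_
    have hpos : 0 < β₁ * β₂ * P_D / (β₂ * P_D - 2 * β₁) := by
      have := h1.1
      rw [cTwo] at this
      linarith
    have hne : β₂ * P_D - 2 * β₁ ≠ 0 := by
      intro h0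
      simp [h0] at hpos
    have hstat : 2 * β₁ * (cTwo β₁ β₂ P_D - β₂ * P_D / 2) -
        β₂ * P_D * (cTwo β₁ β₂ P_D - β₂ * P_D / 2 - β₁) = 0 := by
      rw [cTwo, add_sub_cancel_left]
      field_simp
      ring
    rw [hstat, zero_mul]
  by_cases h2 : H < L
  · have hcand : candSet β₁ β₂ P_D r_C r_D R_th = {C₁} := by
      rw [candSet, if_neg h1, if_pos h2]
    refine ⟨C₁, by simp [hcand], hC₁0, hC₁UD, fun c _ hU => ?_⟩
    rcases le_total c L with hc | hc
    · exact hC₁max c hc hU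
    · exact absurd (hc.trans ((hUDhigh c hc).1 hU)) h2.not_ge
  have hcand : candSet β₁ β₂ P_D r_C r_D R_th = {C₁, H, L} := by
    rw [candSet, if_neg h1, if_neg h2]
  have hLH : L ≤ H := not_lt.1 h2
  by_cases hdec : 2 * β₁ * (L - β₂ * P_D / 2) ≤ β₂ * P_D * (L - β₂ * P_D / 2 - β₁)
  · exact combine L (by simp [hcand]) (by simp [hcand]) le_rfl hLH fun c hc _ =>
      mul_nonneg_of_nonpos_of_nonpos (sub_nonpos.2 hdec) (sub_nonpos.2 hc)
  · refine combine H (by simp [hcand]) (by simp [hcand]) hLH le_rfl fun c _ hc =>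
      mul_nonneg (sub_nonneg.2 ?_) (sub_nonneg.2 hc)
    rcases le_or_gt (β₂ * P_D) (2 * β₁) with hle | hgt
    · nlinarith [mul_nonneg (sub_nonneg.2 hle) (by linarith : 0 ≤ H - β₂ * P_D / 2)]
    · have hden : 0 < β₂ * P_D - 2 * β₁ := sub_pos.2 hgt
      have hL2 : L < cTwo β₁ β₂ P_D := by
        rw [cTwo, ← sub_lt_iff_lt_add', lt_div_iff₀ hden]
        linarith
      have hH2 : H ≤ cTwo β₁ β₂ P_D := not_lt.1 fun h => h1 ⟨hL2, h⟩
      rw [cTwo, ← sub_le_iff_le_add', le_div_iff₀ hden] at hH2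
      linarith
end

section
/- Assume r_C > 2·R_th, β₁·Real.log((1 − 2·R_th/r_C)·r_D) − β₂·P_D·R_th/r_C ≥ 0, and β₂·P_D < 2·β₁. If c* ≥ 0 satisfies the follower-participation constraint U_D(α*(c*), c*) ≥ 0 and maximizes the leader's payoff over all feasible prices — i.e., U_C(α*(c), c) ≤ U_C(α*(c*), c*) for every c ≥ 0 with U_D(α*(c), c) ≥ 0 — then the follower's equilibrium payoff is exactly zero: U_D(α*(c*), c*) = 0. -/
theorem astar_of_le {β₁ β₂ P_D r_C R_th c : ℝ} (h : c ≤ clo β₁ β₂ P_D r_C R_th) :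
    astar β₁ β₂ P_D r_C R_th c = R_th / r_C :=
  if_pos h

/-- The two branches of the best response agree at the threshold price. -/
theorem astar_of_ge {β₁ β₂ P_D r_C R_th c : ℝ} (hβ₁ : 0 < β₁) (hrC : 0 < r_C)
    (hfeas : 2 * R_th < r_C) (h : clo β₁ β₂ P_D r_C R_th ≤ c) :
    astar β₁ β₂ P_D r_C R_th c = 1 / 2 - β₁ / (2 * c - β₂ * P_D) := by
  rcases h.eq_or_lt with rfl | h
  · have hd : r_C - 2 * R_th ≠ 0 := by linarith
    have ht : 2 * clo β₁ β₂ P_D r_C R_th - β₂ * P_D = 2 * (β₁ * r_C / (r_C - 2 * R_th)) := by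
      unfold clo
      ring
    rw [astar_of_le le_rfl, ht]
    field_simp
    ring
  · exact if_neg h.not_ge

theorem two_mul_lt_of_clo_le {β₁ β₂ P_D r_C R_th c : ℝ} (hβ₁ : 0 < β₁) (hRth : 0 < R_th)
    (hfeas : 2 * R_th < r_C) (h : clo β₁ β₂ P_D r_C R_th ≤ c) :
    2 * β₁ < 2 * c - β₂ * P_D := by
  have hd : 0 < r_C - 2 * R_th := by linarith
  have : β₁ < β₁ * r_C / (r_C - 2 * R_th) := by
    rw [lt_div_iff₀ hd]
    nlinarith
  unfold clo at h
  linarith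

theorem continuousAt_UD {β₁ β₂ P_D r_D c : ℝ} {a : ℝ → ℝ} (hrD : 0 < r_D)
    (ha : ContinuousAt a c) (hac : a c < 1 / 2) :
    ContinuousAt (fun x => UD β₁ β₂ P_D r_D x (a x)) c := by
  have hne : (1 - 2 * a c) * r_D ≠ 0 := (mul_pos (by linarith) hrD).ne'
  unfold UD
  fun_prop (disch := assumption)

/-- Above the threshold the leader's payoff is strictly increasing in the price. -/
theorem UC_lt_UC_of_lt {β₁ k r_C c d : ℝ} (hβ₁ : 0 < β₁) (hrC : 0 < r_C)
    (hk : k < 2 * β₁) (hc : 2 * β₁ < 2 * c - k) (hcd : c < d) :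
    UC β₁ r_C c (1 / 2 - β₁ / (2 * c - k)) < UC β₁ r_C d (1 / 2 - β₁ / (2 * d - k)) := by
  have hc0 : 0 < 2 * c - k := by linarith
  have hd0 : 0 < 2 * d - k := by linarith
  have payoff (e : ℝ) (he : 0 < 2 * e - k) :
      e * (1 - 2 * (1 / 2 - β₁ / (2 * e - k))) = β₁ + k * (β₁ / (2 * e - k)) := by
    linear_combination div_mul_cancel₀ β₁ he.ne'
  unfold UC
  rw [payoff c hc0, payoff d hd0]
  have hx : β₁ / (2 * c - k) < 1 / 2 := by
    rw [div_lt_iff₀ hc0]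
    linarith
  have hyx : β₁ / (2 * d - k) < β₁ / (2 * c - k) := by
    gcongr
  have hy0 : 0 < β₁ / (2 * d - k) := div_pos hβ₁ hd0
  generalize β₁ / (2 * c - k) = x at *
  generalize β₁ / (2 * d - k) = y at *
  have hu : 0 < 1 / 2 - y := by linarith
  have hv : 0 < 1 / 2 - x := by linarith
  rw [Real.log_mul hv.ne' hrC.ne', Real.log_mul hu.ne' hrC.ne']
  have hlog := Real.log_le_sub_one_of_pos (div_pos hv hu)
  rw [Real.log_div hv.ne' hu.ne'] at hlog
  have hratio : (1 / 2 - x) / (1 / 2 - y) - 1 ≤ -(2 * (x - y)) := by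
    rw [sub_le_iff_le_add, div_le_iff₀ hu]
    nlinarith [mul_pos hy0 (sub_pos.2 hyx)]
  nlinarith [mul_le_mul_of_nonneg_left (hlog.trans hratio) hβ₁.le,
    mul_pos (sub_pos.2 hk) (sub_pos.2 hyx)]

/-- Proposition 2: if β₂ P_D < 2 β₁, any leader-optimal feasible price c*
gives the follower an equilibrium payoff of exactly zero. -/
theorem stmt4 (β₁ β₂ P_D r_C r_D R_th cstar : ℝ)
    (hβ₁ : 0 < β₁) (hβ₂ : 0 < β₂) (hPD : 0 < P_D) (hrC : 0 < r_C) (hrD : 0 < r_D)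
    (hRth : 0 < R_th)
    (hfeas1 : r_C > 2 * R_th)
    (hfeas2 : β₁ * Real.log ((1 - 2 * R_th / r_C) * r_D) - β₂ * P_D * R_th / r_C ≥ 0)
    (hsmall : β₂ * P_D < 2 * β₁)
    (hc0 : cstar ≥ 0)
    (hpart : UD β₁ β₂ P_D r_D cstar (astar β₁ β₂ P_D r_C R_th cstar) ≥ 0)
    (hopt : ∀ c : ℝ, c ≥ 0 → UD β₁ β₂ P_D r_D c (astar β₁ β₂ P_D r_C R_th c) ≥ 0 →
      UC β₁ r_C c (astar β₁ β₂ P_D r_C R_th c) ≤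
        UC β₁ r_C cstar (astar β₁ β₂ P_D r_C R_th cstar)) :
    UD β₁ β₂ P_D r_D cstar (astar β₁ β₂ P_D r_C R_th cstar) = 0 := by
  by_contra hne
  have hpos := lt_of_le_of_ne hpart (Ne.symm hne)
  rcases lt_or_ge cstar (clo β₁ β₂ P_D r_C R_th) with hlt | hge
  · have hα : R_th / r_C < 1 / 2 := by
      rw [div_lt_iff₀ hrC]
      linarith
    rw [astar_of_le hlt.le] at hpos hopt
    have hev := (continuousAt_UD hrD (continuousAt_const (x := cstar)) hα).eventually
      (lt_mem_nhds hpos)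
    obtain ⟨c, hc, hcgt, hclo⟩ := ((hev.filter_mono nhdsWithin_le_nhds).and
      (Ioo_mem_nhdsGT hlt)).exists
    have h := hopt c (hc0.le.trans hcgt.le)
    rw [astar_of_le hclo.le] at h
    have h := h hc.le
    unfold UC at h
    nlinarith [mul_pos (sub_pos.2 hcgt) (sub_pos.2 hα)]
  · have ht := two_mul_lt_of_clo_le hβ₁ hRth hfeas1 hge
    have ht0 : 2 * cstar - β₂ * P_D ≠ 0 := by linarith
    rw [astar_of_ge hβ₁ hrC hfeas1 hge] at hpos hopt
    have hcont : ContinuousAt (fun c => 1 / 2 - β₁ / (2 * c - β₂ * P_D)) cstar := by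
      fun_prop (disch := assumption)
    have hα : 1 / 2 - β₁ / (2 * cstar - β₂ * P_D) < 1 / 2 :=
      sub_lt_self _ (div_pos hβ₁ (by linarith))
    have hev := (continuousAt_UD hrD hcont hα).eventually (lt_mem_nhds hpos)
    obtain ⟨c, hc, hcgt⟩ := ((hev.filter_mono nhdsWithin_le_nhds).and
      (self_mem_nhdsWithin (s := Set.Ioi cstar))).exists
    have h := hopt c (hc0.le.trans hcgt.le)
    rw [astar_of_ge hβ₁ hrC hfeas1 (hge.trans hcgt.le)] at h
    exact (UC_lt_UC_of_lt hβ₁ hrC hsmall ht hcgt).not_ge (h hc.le)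
end

section
/- Assume r_C > 2·R_th, and set X = (β₁·Real.log((1 − 2·R_th/r_C)·r_D) − β₂·P_D·R_th/r_C)/(1 − 2·R_th/r_C). Then c_lo ≤ X if and only if c_lo ≤ c_hi, where c_lo = β₂·P_D/2 + β₁·r_C/(r_C − 2·R_th) and c_hi = β₂·P_D/2 + β₁·r_D·Real.exp(−(1 + β₂·P_D/(2·β₁))). In particular, if c_lo ≤ X then β₁·r_D/Real.exp(1 + β₂·P_D/(2·β₁)) ≥ β₁·r_C/(r_C − 2·R_th). -/
/-- with X as stated, c_lo ≤ X iff c_lo ≤ c_hi; in particular, if c_lo ≤ X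
then β₁ r_D / exp(1 + β₂ P_D/(2β₁)) ≥ β₁ r_C/(r_C − 2 R_th). -/
theorem stmt5 (β₁ β₂ P_D r_C r_D R_th : ℝ)
    (hβ₁ : 0 < β₁) (hβ₂ : 0 < β₂) (hPD : 0 < P_D) (hrC : 0 < r_C) (hrD : 0 < r_D)
    (hRth : 0 < R_th)
    (hfeas : r_C > 2 * R_th) :
    ((β₂ * P_D / 2 + β₁ * r_C / (r_C - 2 * R_th) ≤
        (β₁ * Real.log ((1 - 2 * R_th / r_C) * r_D) - β₂ * P_D * R_th / r_C) /
          (1 - 2 * R_th / r_C)) ↔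
      (β₂ * P_D / 2 + β₁ * r_C / (r_C - 2 * R_th) ≤
        β₂ * P_D / 2 + β₁ * r_D * Real.exp (-(1 + β₂ * P_D / (2 * β₁))))) ∧
    ((β₂ * P_D / 2 + β₁ * r_C / (r_C - 2 * R_th) ≤
        (β₁ * Real.log ((1 - 2 * R_th / r_C) * r_D) - β₂ * P_D * R_th / r_C) /
          (1 - 2 * R_th / r_C)) →
      β₁ * r_D / Real.exp (1 + β₂ * P_D / (2 * β₁)) ≥ β₁ * r_C / (r_C - 2 * R_th)) := by
  obtain ⟨t, ht⟩ : ∃ t, t = 1 - 2 * R_th / r_C := ⟨_, rfl⟩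
  have htpos : 0 < t := by
    rw [ht, sub_pos, div_lt_one hrC]
    exact hfeas
  have hratio : R_th / r_C = (1 - t) / 2 := by
    rw [ht]
    ring
  have hrC_sub : r_C - 2 * R_th = t * r_C := by
    rw [ht]
    field_simp
  have hlo : β₁ * r_C / (r_C - 2 * R_th) = β₁ / t := by
    rw [hrC_sub]
    field_simp
  have hX : (β₂ * P_D / 2 + β₁ / t ≤
      (β₁ * Real.log (t * r_D) - β₂ * P_D * R_th / r_C) / t) ↔
      Real.exp (1 + β₂ * P_D / (2 * β₁)) ≤ t * r_D := by
    rw [← Real.le_log_iff_exp_le (mul_pos htpos hrD), mul_div_assoc _ R_th, hratio,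
      le_div_iff₀ htpos,
      ← mul_le_mul_iff_right₀ hβ₁ (b := 1 + β₂ * P_D / (2 * β₁))]
    have h₁ : (β₂ * P_D / 2 + β₁ / t) * t = β₂ * P_D / 2 * t + β₁ := by field_simp
    have h₂ : β₁ * (1 + β₂ * P_D / (2 * β₁)) = β₁ + β₂ * P_D / 2 := by field_simp
    rw [h₁, h₂]
    constructor <;> intro h <;> linarith
  have hhi : β₁ / t ≤ β₁ * r_D / Real.exp (1 + β₂ * P_D / (2 * β₁)) ↔
      Real.exp (1 + β₂ * P_D / (2 * β₁)) ≤ t * r_D := by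
    rw [div_le_div_iff₀ htpos (Real.exp_pos _), mul_assoc, mul_le_mul_iff_right₀ hβ₁,
      mul_comm r_D]
  rw [hlo, ← ht, hX, add_le_add_iff_left, Real.exp_neg, ← div_eq_mul_inv, hhi, ge_iff_le, hhi]
  exact ⟨Iff.rfl, id⟩
end

section
/- Assume r_C > 2·R_th. For every price c > c_lo, the follower's optimal payoff admits the closed form U_D(α*(c), c) = β₁·Real.log(2·β₁·r_D/(2c − β₂·P_D)) − β₂·P_D/2 − β₁. Consequently, if c_hi > c_lo, where c_hi = β₂·P_D/2 + β₁·r_D·Real.exp(−(1 + β₂·P_D/(2·β₁))), then U_D(α*(c_hi), c_hi) = 0. -/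
/-- The payoff at the interior best response `1 / 2 - β₁ / (2 * c - β₂ * P_D)`. -/
theorem UD_interior (β₁ β₂ P_D r_D c : ℝ) (hD : 2 * c - β₂ * P_D ≠ 0) :
    UD β₁ β₂ P_D r_D c (1 / 2 - β₁ / (2 * c - β₂ * P_D)) =
      β₁ * Real.log (2 * β₁ * r_D / (2 * c - β₂ * P_D)) - β₂ * P_D / 2 - β₁ := by
  have harg : (1 - 2 * (1 / 2 - β₁ / (2 * c - β₂ * P_D))) * r_D =
      2 * β₁ * r_D / (2 * c - β₂ * P_D) := by ring
  have hcancel : β₁ / (2 * c - β₂ * P_D) * (2 * c - β₂ * P_D) = β₁ := div_mul_cancel₀ _ hD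
  rw [UD, harg]
  linear_combination -hcancel

/-- closed form of the follower's optimal payoff for c > c_lo, and
consequently U_D(α*(c_hi), c_hi) = 0 whenever c_hi > c_lo. -/
theorem stmt7 (β₁ β₂ P_D r_C r_D R_th : ℝ)
    (hβ₁ : 0 < β₁) (hβ₂ : 0 < β₂) (hPD : 0 < P_D) (hrC : 0 < r_C) (hrD : 0 < r_D)
    (hRth : 0 < R_th)
    (hfeas : r_C > 2 * R_th) :
    (∀ c : ℝ, c > clo β₁ β₂ P_D r_C R_th →
      UD β₁ β₂ P_D r_D c (astar β₁ β₂ P_D r_C R_th c) =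
        β₁ * Real.log (2 * β₁ * r_D / (2 * c - β₂ * P_D)) - β₂ * P_D / 2 - β₁) ∧
    (chi β₁ β₂ P_D r_D > clo β₁ β₂ P_D r_C R_th →
      UD β₁ β₂ P_D r_D (chi β₁ β₂ P_D r_D)
        (astar β₁ β₂ P_D r_C R_th (chi β₁ β₂ P_D r_D)) = 0) := by
  have key : ∀ c : ℝ, c > clo β₁ β₂ P_D r_C R_th →
      UD β₁ β₂ P_D r_D c (astar β₁ β₂ P_D r_C R_th c) =
        β₁ * Real.log (2 * β₁ * r_D / (2 * c - β₂ * P_D)) - β₂ * P_D / 2 - β₁ := by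
    intro c hc
    have hpos : 0 < β₁ * r_C / (r_C - 2 * R_th) :=
      div_pos (mul_pos hβ₁ hrC) (sub_pos.mpr hfeas)
    rw [astar, if_neg (not_le.mpr hc)]
    rw [clo] at hc
    exact UD_interior β₁ β₂ P_D r_D c (by linarith)
  refine ⟨key, fun h => ?_⟩
  have hratio : 2 * β₁ * r_D / (2 * chi β₁ β₂ P_D r_D - β₂ * P_D) =
      Real.exp (1 + β₂ * P_D / (2 * β₁)) := by
    have hden : 2 * chi β₁ β₂ P_D r_D - β₂ * P_D =
        2 * β₁ * r_D * (Real.exp (1 + β₂ * P_D / (2 * β₁)))⁻¹ := by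
      rw [chi, Real.exp_neg]
      ring
    rw [hden]
    field_simp
  rw [key _ h, hratio, Real.log_exp]
  field_simp
  ring
end

section
/- Assume r_C > 2·R_th. Then the follower's value function c ↦ U_D(α*(c), c) is strictly decreasing on [0, ∞): for all prices c, c' with 0 ≤ c < c', one has U_D(α*(c'), c') < U_D(α*(c), c). -/
/-- First-order sufficient condition: by concavity of the payoff in the time allocation, `b` is at
least as good as `a` when the marginal payoff at `b` does not point towards `a`. -/
theorem UD_le_UD_of_marginal {β₁ β₂ P_D r_D c a b : ℝ} (hβ₁ : 0 < β₁) (hrD : 0 < r_D)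
    (ha : 0 < 1 - 2 * a) (hb : 0 < 1 - 2 * b)
    (h : 0 ≤ (β₁ - (c - β₂ * P_D / 2) * (1 - 2 * b)) * (a - b)) :
    UD β₁ β₂ P_D r_D c a ≤ UD β₁ β₂ P_D r_D c b := by
  have hlog := Real.log_le_sub_one_of_pos (div_pos ha hb)
  rw [Real.log_div ha.ne' hb.ne'] at hlog
  have hmul := mul_le_mul_of_nonneg_left hlog hβ₁.le
  have hlin : β₁ * ((1 - 2 * a) / (1 - 2 * b) - 1) ≤ (c - β₂ * P_D / 2) * (2 * b - 2 * a) := by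
    have heq : β₁ * ((1 - 2 * a) / (1 - 2 * b) - 1) = β₁ * (2 * b - 2 * a) / (1 - 2 * b) := by
      field_simp
      ring
    rw [heq, div_le_iff₀ hb]
    linarith
  unfold UD
  rw [Real.log_mul ha.ne' hrD.ne', Real.log_mul hb.ne' hrD.ne']
  linarith

/-- The payoff is strictly decreasing in the price at a fixed time allocation. -/
theorem UD_lt_UD_of_price_lt {β₁ β₂ P_D r_D c c' a : ℝ} (ha : 0 < 1 - 2 * a) (h : c < c') :
    UD β₁ β₂ P_D r_D c' a < UD β₁ β₂ P_D r_D c a := by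
  unfold UD
  have := mul_lt_mul_of_pos_right h ha
  linarith

theorem mul_lt_of_clo_lt {β₁ β₂ P_D r_C R_th c : ℝ} (hrC : 0 < r_C) (hfeas : 2 * R_th < r_C)
    (h : clo β₁ β₂ P_D r_C R_th < c) : β₁ < (c - β₂ * P_D / 2) * (1 - 2 * (R_th / r_C)) := by
  have hd : 0 < r_C - 2 * R_th := by linarith
  have h' : β₁ * r_C / (r_C - 2 * R_th) < c - β₂ * P_D / 2 := by
    unfold clo at h
    linarith
  rw [div_lt_iff₀ hd] at h'
  have heq : (c - β₂ * P_D / 2) * (1 - 2 * (R_th / r_C)) =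
      (c - β₂ * P_D / 2) * (r_C - 2 * R_th) / r_C := by
    field_simp
  rwa [heq, lt_div_iff₀ hrC]

theorem mul_le_of_le_clo {β₁ β₂ P_D r_C R_th c : ℝ} (hrC : 0 < r_C) (hfeas : 2 * R_th < r_C)
    (h : c ≤ clo β₁ β₂ P_D r_C R_th) : (c - β₂ * P_D / 2) * (1 - 2 * (R_th / r_C)) ≤ β₁ := by
  have hd : 0 < r_C - 2 * R_th := by linarith
  have h' : c - β₂ * P_D / 2 ≤ β₁ * r_C / (r_C - 2 * R_th) := by
    unfold clo at h
    linarith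
  rw [le_div_iff₀ hd] at h'
  have heq : (c - β₂ * P_D / 2) * (1 - 2 * (R_th / r_C)) =
      (c - β₂ * P_D / 2) * (r_C - 2 * R_th) / r_C := by
    field_simp
  rwa [heq, div_le_iff₀ hrC]

theorem one_sub_two_mul_div_pos {r_C R_th : ℝ} (hrC : 0 < r_C) (hfeas : 2 * R_th < r_C) :
    0 < 1 - 2 * (R_th / r_C) := by
  have : R_th / r_C < 1 / 2 := by
    rw [div_lt_iff₀ hrC]
    linarith
  linarith

theorem sub_pos_of_clo_lt {β₁ β₂ P_D r_C R_th c : ℝ} (hβ₁ : 0 < β₁) (hrC : 0 < r_C)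
    (hfeas : 2 * R_th < r_C) (h : clo β₁ β₂ P_D r_C R_th < c) : 0 < 2 * c - β₂ * P_D := by
  have := pos_of_mul_pos_left (hβ₁.trans (mul_lt_of_clo_lt hrC hfeas h))
    (one_sub_two_mul_div_pos hrC hfeas).le
  linarith

/-- The best response leaves a positive share of time to the D2D link. -/
theorem one_sub_two_mul_astar_pos {β₁ β₂ P_D r_C R_th : ℝ} (hβ₁ : 0 < β₁) (hrC : 0 < r_C)
    (hfeas : 2 * R_th < r_C) (c : ℝ) : 0 < 1 - 2 * astar β₁ β₂ P_D r_C R_th c := by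
  unfold astar
  split_ifs with h
  · exact one_sub_two_mul_div_pos hrC hfeas
  · have := div_pos hβ₁ (sub_pos_of_clo_lt hβ₁ hrC hfeas (not_le.mp h))
    linarith

/-- The best response meets the cellular rate requirement. -/
theorem div_le_astar {β₁ β₂ P_D r_C R_th : ℝ} (hβ₁ : 0 < β₁) (hrC : 0 < r_C)
    (hfeas : 2 * R_th < r_C) (c : ℝ) : R_th / r_C ≤ astar β₁ β₂ P_D r_C R_th c := by
  unfold astar
  split_ifs with h
  · exact le_rfl
  · have h' := not_le.mp h
    have : β₁ / (2 * c - β₂ * P_D) ≤ 1 / 2 - R_th / r_C := by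
      rw [div_le_iff₀ (sub_pos_of_clo_lt hβ₁ hrC hfeas h')]
      linarith [mul_lt_of_clo_lt hrC hfeas h']
    linarith

/-- The best response maximizes the payoff over all feasible time allocations. -/
theorem UD_le_UD_astar {β₁ β₂ P_D r_C r_D R_th a : ℝ} (hβ₁ : 0 < β₁) (hrC : 0 < r_C)
    (hrD : 0 < r_D) (hfeas : 2 * R_th < r_C) (hRa : R_th / r_C ≤ a) (ha : 0 < 1 - 2 * a) (c : ℝ) :
    UD β₁ β₂ P_D r_D c a ≤ UD β₁ β₂ P_D r_D c (astar β₁ β₂ P_D r_C R_th c) := by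
  refine UD_le_UD_of_marginal hβ₁ hrD ha (one_sub_two_mul_astar_pos hβ₁ hrC hfeas c) ?_
  unfold astar
  split_ifs with h
  · exact mul_nonneg (sub_nonneg.mpr (mul_le_of_le_clo hrC hfeas h)) (sub_nonneg.mpr hRa)
  · have hne := (sub_pos_of_clo_lt hβ₁ hrC hfeas (not_le.mp h)).ne'
    have hz : β₁ - (c - β₂ * P_D / 2) * (1 - 2 * (1 / 2 - β₁ / (2 * c - β₂ * P_D))) = 0 := by
      linear_combination -div_mul_cancel₀ β₁ hne
    rw [hz, zero_mul]

/-- if r_C > 2 R_th, the follower's value function c ↦ U_D(α*(c), c) is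
strictly decreasing on [0, ∞). -/
theorem stmt8 (β₁ β₂ P_D r_C r_D R_th : ℝ)
    (hβ₁ : 0 < β₁) (hβ₂ : 0 < β₂) (hPD : 0 < P_D) (hrC : 0 < r_C) (hrD : 0 < r_D)
    (hRth : 0 < R_th)
    (hfeas : r_C > 2 * R_th) :
    ∀ c c' : ℝ, 0 ≤ c → c < c' →
      UD β₁ β₂ P_D r_D c' (astar β₁ β₂ P_D r_C R_th c') <
        UD β₁ β₂ P_D r_D c (astar β₁ β₂ P_D r_C R_th c) := by
  intro c c' _ hc
  have hpos := one_sub_two_mul_astar_pos (β₂ := β₂) (P_D := P_D) hβ₁ hrC hfeas c'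
  exact (UD_lt_UD_of_price_lt hpos hc).trans_le
    (UD_le_UD_astar hβ₁ hrC hrD hfeas (div_le_astar hβ₁ hrC hfeas c') hpos c)
end

section
/- Assume r_C > 2·R_th and β₁·Real.log((1 − 2·R_th/r_C)·r_D) − β₂·P_D·R_th/r_C < 0. Then for every price c ≥ 0, the follower's optimal payoff is negative: U_D(α*(c), c) < 0. That is, the leader's pricing problem under the follower-participation constraint U_D(α*(c), c) ≥ 0 is infeasible. -/
/-- For a nonnegative price, the payoff at `α` is at most the price-free payoff at any smaller
time allocation. -/
theorem UD_le_of_le {β₁ β₂ P_D r_D c α₀ α : ℝ} (hβ₁ : 0 ≤ β₁) (hβ₂ : 0 ≤ β₂) (hPD : 0 ≤ P_D)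
    (hrD : 0 < r_D) (hc : 0 ≤ c) (hα₀ : α₀ ≤ α) (hα : α < 1 / 2) :
    UD β₁ β₂ P_D r_D c α ≤ UD β₁ β₂ P_D r_D 0 α₀ := by
  have ht : 0 < 1 - 2 * α := by linarith
  have hlog : Real.log ((1 - 2 * α) * r_D) ≤ Real.log ((1 - 2 * α₀) * r_D) :=
    Real.log_le_log (mul_pos ht hrD) (by gcongr)
  have hrevenue := mul_le_mul_of_nonneg_left hlog hβ₁
  have henergy := mul_le_mul_of_nonneg_left hα₀ (mul_nonneg hβ₂ hPD)
  have hprice := mul_nonneg hc ht.le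
  unfold UD
  linarith

/-- The best response meets the rate requirement and leaves a positive share of time to the
D2D link. -/
theorem astar_mem_Ico {β₁ β₂ P_D r_C R_th : ℝ} (c : ℝ) (hβ₁ : 0 < β₁) (hrC : 0 < r_C)
    (hfeas : 2 * R_th < r_C) :
    astar β₁ β₂ P_D r_C R_th c ∈ Set.Ico (R_th / r_C) (1 / 2) := by
  have hd : 0 < r_C - 2 * R_th := by linarith
  unfold astar
  split_ifs with h
  · exact ⟨le_rfl, by rw [div_lt_iff₀ hrC]; linarith⟩
  · unfold clo at h
    have hlo : 2 * (β₁ * r_C / (r_C - 2 * R_th)) < 2 * c - β₂ * P_D := by linarith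
    have hpos : 0 < 2 * c - β₂ * P_D := lt_trans (by positivity) hlo
    have hshare : β₁ / (2 * c - β₂ * P_D) ≤ 1 / 2 - R_th / r_C := by
      rw [← mul_div_assoc, div_lt_iff₀ hd] at hlo
      have heq : 1 / 2 - R_th / r_C = (r_C - 2 * R_th) / (2 * r_C) := by field_simp
      rw [heq, div_le_div_iff₀ hpos (by positivity)]
      linarith
    exact ⟨by linarith, by linarith [div_pos hβ₁ hpos]⟩

/-- if β₁ log((1 − 2 R_th/r_C) r_D) − β₂ P_D R_th/r_C < 0, then for every
c ≥ 0 the follower's optimal payoff is negative: the leader's pricing problem under the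
participation constraint is infeasible. -/
theorem stmt9 (β₁ β₂ P_D r_C r_D R_th : ℝ)
    (hβ₁ : 0 < β₁) (hβ₂ : 0 < β₂) (hPD : 0 < P_D) (hrC : 0 < r_C) (hrD : 0 < r_D)
    (hRth : 0 < R_th)
    (hfeas : r_C > 2 * R_th)
    (hneg : β₁ * Real.log ((1 - 2 * R_th / r_C) * r_D) - β₂ * P_D * R_th / r_C < 0) :
    ∀ c : ℝ, c ≥ 0 → UD β₁ β₂ P_D r_D c (astar β₁ β₂ P_D r_C R_th c) < 0 := by
  intro c hc
  obtain ⟨hlo, hhi⟩ := astar_mem_Ico (β₂ := β₂) (P_D := P_D) c hβ₁ hrC hfeas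
  refine (UD_le_of_le hβ₁.le hβ₂.le hPD.le hrD hc hlo hhi).trans_lt ?_
  simpa [UD, mul_div_assoc] using hneg
end
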